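/- arXiv:2410.19967 — 6 statements merged into one kernel-verified Lean document; each statement's English description precedes it below -/
import Mathlib

section
/- Let a : L → ℝ be absolutely summable and even, with Σ_{k∈L} (1−|k|²)² a_k² < ∞, and let λ ∈ ℝ. Set N = Σ_{k∈L} a_k² and define F_k = −(1−|k|²)² a_k + λ a_k − (a*a*a)_k for k ∈ L. Then Σ_{k∈L} a_k F_k ≤ N(λ − N). (Energy inequality ⟨u, F(u,λ)⟩ ≤ ‖u‖₂²(λ − ‖u‖₂²) from the proof of Theorem 3.1(a,b), for the Swift–Hohenberg nonlinearity F(u,λ) = −(Δ+1)²u + λu − u³ expressed in Fourier amplitudes) -/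
/-- Convolution of amplitude functions on an additive subgroup `L` of `ℝ^d`:
`(a*b)_k = ∑_{m∈L} a_m b_{k−m}`. -/
noncomputable def ampConv {d : ℕ} {L : AddSubgroup (EuclideanSpace ℝ (Fin d))}
    (a b : L → ℝ) : L → ℝ :=
  fun k => ∑' m : L, a m * b (k - m)

/-- The energy inequality `⟨u, F(u,λ)⟩ ≤ ‖u‖₂²(λ − ‖u‖₂²)` from the proof of
Theorem 3.1(a,b), for the Swift–Hohenberg nonlinearity
`F(u,λ) = −(Δ+1)²u + λu − u³` expressed in Fourier amplitudes:
`Fₖ = −(1−|k|²)² aₖ + λ aₖ − (a*a*a)ₖ` and `N = ∑ₖ aₖ²`, then `∑ₖ aₖ Fₖ ≤ N(λ−N)`. -/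
theorem statement_6 {d : ℕ} (L : AddSubgroup (EuclideanSpace ℝ (Fin d)))
    (a : L → ℝ)
    (ha : Summable fun k => |a k|)
    (haeven : ∀ k, a (-k) = a k)
    (ha2 : Summable fun k : L => (1 - ‖(k : EuclideanSpace ℝ (Fin d))‖ ^ 2) ^ 2 * (a k) ^ 2)
    (lam : ℝ)
    (N : ℝ) (hN : N = ∑' k : L, (a k) ^ 2)
    (F : L → ℝ)
    (hF : ∀ k : L, F k = -(1 - ‖(k : EuclideanSpace ℝ (Fin d))‖ ^ 2) ^ 2 * a k
        + lam * a k - ampConv (ampConv a a) a k) :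
    (∑' k : L, a k * F k) ≤ N * (lam - N) := by
  have hA : ∀ k, |a k| ≤ ∑' k, |a k| := fun k => ha.le_tsum k (fun j _ => abs_nonneg _)
  have ha' : Summable a := ha.of_abs
  have hprod : Summable fun p : L × L => a p.1 * a p.2 :=
    summable_mul_of_summable_norm (f := a) (g := a) ha ha
  let e : L × L ≃ L × L :=
    { toFun := fun p => (p.2, p.1 - p.2)
      invFun := fun p => (p.1 + p.2, p.1)
      left_inv := fun p => by simp
      right_inv := fun p => by simp }
  have hprod2 : Summable fun p : L × L => a p.2 * a (p.1 - p.2) :=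
    (e.summable_iff (f := fun p : L × L => a p.1 * a p.2)).2 hprod
  set c : L → ℝ := ampConv a a with hc
  have hcdef : ∀ k, c k = ∑' m, a m * a (k - m) := fun k => rfl
  have hcs : Summable c := hprod2.prod
  have hca : Summable fun k => |c k| := hcs.abs
  have hac : Summable fun p : L × L => a p.1 * c p.2 :=
    summable_mul_of_summable_norm (f := a) (g := c) ha hca
  have hT : Summable fun p : L × L => a p.1 * (c p.2 * a (p.1 - p.2)) := by
    refine Summable.of_norm_bounded (g := fun p : L × L => |a p.1 * c p.2| * ∑' k, |a k|)
      (hac.abs.mul_right _) ?_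
    intro p
    rw [← mul_assoc, Real.norm_eq_abs, abs_mul]
    exact mul_le_mul_of_nonneg_left (hA _) (abs_nonneg _)
  have hT1 : ∀ k, a k * ampConv c a k = ∑' m, a k * (c m * a (k - m)) := by
    intro k
    rw [tsum_mul_left]; rfl
  have hT2 : ∀ m, ∑' k, a k * (c m * a (k - m)) = c m ^ 2 := by
    intro m
    rw [pow_two]
    nth_rewrite 3 [hcdef m]
    rw [← tsum_mul_left]
    refine tsum_congr fun k => ?_
    rw [← haeven (k - m), neg_sub]; ring
  have hsum3 : Summable fun k => a k * ampConv c a k := by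
    simp_rw [hT1]; exact hT.prod
  have hc2 : Summable fun m => c m ^ 2 := by
    have := hT.prod_symm.prod
    simpa [hT2] using this
  have h3 : ∑' k, a k * ampConv c a k = ∑' m, c m ^ 2 := by
    simp_rw [hT1]
    rw [← tsum_congr hT2]
    exact Summable.tsum_comm (f := fun m k => a k * (c m * a (k - m))) hT.prod_symm
  have hc0 : c 0 = N := by
    rw [hcdef, hN]
    refine tsum_congr fun k => ?_
    rw [zero_sub, haeven, pow_two]
  have h4 : N ^ 2 ≤ ∑' k, a k * ampConv c a k := by
    rw [h3, ← hc0]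
    exact hc2.le_tsum 0 (fun j _ => sq_nonneg _)
  have hN2 : Summable fun k => a k ^ 2 := by
    refine Summable.of_norm_bounded (g := fun k => |a k| * ∑' k, |a k|) (ha.mul_right _) ?_
    intro k
    rw [pow_two, Real.norm_eq_abs, abs_mul]
    exact mul_le_mul_of_nonneg_left (hA _) (abs_nonneg _)
  have hpt : ∀ k : L, a k * F k = lam * a k ^ 2 - a k * ampConv c a k
      - (1 - ‖(k : EuclideanSpace ℝ (Fin d))‖ ^ 2) ^ 2 * (a k) ^ 2 := by
    intro k; rw [hF]; ring
  rw [tsum_congr hpt, ((hN2.mul_left lam).sub hsum3).tsum_sub ha2,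
    (hN2.mul_left lam).tsum_sub hsum3, tsum_mul_left, ← hN]
  have h5 : 0 ≤ ∑' k : L, (1 - ‖(k : EuclideanSpace ℝ (Fin d))‖ ^ 2) ^ 2 * (a k) ^ 2 :=
    tsum_nonneg fun k => by positivity
  nlinarith
end

section
/- Let λ > 0 and ε > 0, and let N : [0,∞) → [0,∞) be differentiable with N'(t) ≤ 2 N(t)(λ − N(t)) for all t ≥ 0. Then there exists t₀ ≥ 0 such that N(t) ≤ (1+ε)λ for all t ≥ t₀. (Differential-inequality form of Theorem 3.1(b): for any initial condition, the squared ℓ² norm N(t) = ‖u(t)‖₂² of a Swift–Hohenberg solution is eventually at most (1+ε)λ, i.e. ‖u(t)‖₂ ≤ (1+ε)^{1/2}·√λ eventually) -/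
/-- Differential-inequality form of Theorem 3.1(b): if `λ > 0`, `ε > 0` and
`N : [0,∞) → [0,∞)` is differentiable with `N' ≤ 2N(λ − N)`, then eventually
`N(t) ≤ (1+ε)λ`. -/
theorem statement_10 (lam eps : ℝ) (hlam : 0 < lam) (heps : 0 < eps)
    (N N' : ℝ → ℝ)
    (hpos : ∀ t ∈ Set.Ici (0 : ℝ), 0 ≤ N t)
    (hderiv : ∀ t ∈ Set.Ici (0 : ℝ), HasDerivWithinAt N (N' t) (Set.Ici 0) t)
    (hineq : ∀ t ∈ Set.Ici (0 : ℝ), N' t ≤ 2 * N t * (lam - N t)) :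
    ∃ t₀ : ℝ, 0 ≤ t₀ ∧ ∀ t ≥ t₀, N t ≤ (1 + eps) * lam := by
  have hK : 0 < (1 + eps) * lam := by positivity
  have hel : 0 < eps * lam := by positivity
  have hc : 0 < (1 + eps) * lam * (eps * lam) := by positivity
  have key : ∀ x ∈ Set.Ici (0 : ℝ), (1 + eps) * lam ≤ N x →
      N' x < -((1 + eps) * lam * (eps * lam)) := by
    intro x hx h
    have h1 := hineq x hx
    have h2 : (1 + eps) * lam * (eps * lam) ≤ N x * (N x - lam) :=
      mul_le_mul h (by linarith) hel.le (hpos x hx)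
    linarith
  have hder : ∀ x ∈ Set.Ici (0 : ℝ), HasDerivWithinAt N (N' x) (Set.Ici x) x :=
    fun x hx => (hderiv x hx).mono (Set.Ici_subset_Ici.2 hx)
  have hcont : ContinuousOn N (Set.Ici 0) := fun x hx => (hderiv x hx).continuousWithinAt
  obtain ⟨s, hs, hNs⟩ : ∃ s : ℝ, 0 ≤ s ∧ N s ≤ (1 + eps) * lam := by
    by_contra! hcon
    generalize (1 + eps) * lam * (eps * lam) = c at *
    have hT : 0 ≤ (N 0 + 1) / c := by
      have := hpos 0 (Set.mem_Ici.2 le_rfl)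
      positivity
    have hle := image_le_of_deriv_right_lt_deriv_boundary (f := N) (f' := N')
      (a := 0) (b := (N 0 + 1) / c) (B := fun t => N 0 + t * (-c)) (B' := fun _ => -c)
      (hcont.mono Set.Icc_subset_Ici_self) (fun x hx => hder x hx.1) (by simp)
      (fun x => by simpa using ((hasDerivAt_id x).mul_const (-c)).const_add (N 0))
      (fun x hx _ => key x hx.1 (hcon x hx.1).le) (Set.right_mem_Icc.2 hT)
    have h3 : (N 0 + 1) / c * (-c) = -(N 0 + 1) := by field_simp
    have h4 := hpos _ (Set.mem_Ici.2 hT)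
    simp only [h3] at hle
    linarith
  refine ⟨s, hs, fun t ht => ?_⟩
  exact image_le_of_deriv_right_lt_deriv_boundary (f := N) (f' := N')
      (a := s) (b := t) (B := fun _ => (1 + eps) * lam) (B' := fun _ => 0)
      (hcont.mono fun x hx => hs.trans hx.1) (fun x hx => hder x (hs.trans hx.1)) hNs
      (fun x => hasDerivAt_const x _)
      (fun x hx h => (key x (hs.trans hx.1) h.ge).trans (by linarith)) (Set.right_mem_Icc.2 ht)
end

section
/- Let a, v : L → ℝ be absolutely summable and even, with Σ_{k∈L} (1−|k|²)² |a_k| |v_k| < ∞, and let λ ∈ ℝ. Define F_k = −(1−|k|²)² a_k + λ a_k − (a*a*a)_k. Then Σ_{k∈L} (1−|k|²)² a_k v_k − λ Σ_{k∈L} a_k v_k + Σ_{k∈L} (a*a)_k (a*v)_k = −Σ_{k∈L} F_k v_k. (The identity (dP_λ)_u v = −⟨F(u,λ), v⟩ from the proof of Proposition 3.5, whose key step is ⟨u², uv⟩ = ⟨u³, v⟩; it implies that P_λ decreases along Swift–Hohenberg trajectories with d/dt P_λ(u(t)) = −‖F(u(t),λ)‖₂²) -/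
theorem conv_summable_aux {d : ℕ} {L : AddSubgroup (EuclideanSpace ℝ (Fin d))}
    {a b : L → ℝ} (ha : Summable a) (hb : Summable b) : Summable (ampConv a b) := by
  have h1 : Summable fun p : L × L => a p.1 * b p.2 :=
    summable_mul_of_summable_norm ha.norm hb.norm
  have hinj : Function.Injective (fun p : L × L => ((p.2, p.1 - p.2) : L × L)) := by
    rintro ⟨k, m⟩ ⟨k', m'⟩ h
    simp only [Prod.mk.injEq] at h
    obtain ⟨h1, h2⟩ := h
    subst h1
    simpa using h2
  have h2 := h1.comp_injective hinj
  exact h2.prod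

theorem bdd_aux {ι : Type*} {a : ι → ℝ} (ha : Summable a) : ∃ C, ∀ k, |a k| ≤ C :=
  ⟨∑' k, |a k|, fun k => ha.abs.le_tsum k (fun _ _ => abs_nonneg _)⟩

theorem mul_summable_aux {ι : Type*} {a b : ι → ℝ} (ha : Summable a) (hb : Summable b) :
    Summable fun k => a k * b k := by
  obtain ⟨C, hC⟩ := bdd_aux ha
  refine Summable.of_norm_bounded (hb.abs.mul_left C) fun k => ?_
  rw [Real.norm_eq_abs, abs_mul]
  exact mul_le_mul_of_nonneg_right (hC k) (abs_nonneg _)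

theorem pairing_aux {d : ℕ} {L : AddSubgroup (EuclideanSpace ℝ (Fin d))}
    {a b v : L → ℝ} (ha : Summable a) (hb : Summable b) (hv : Summable v)
    (haeven : ∀ k, a (-k) = a k) :
    ∑' k, b k * ampConv a v k = ∑' k, ampConv b a k * v k := by
  have h1 : Summable fun p : L × L => b p.1 * v p.2 :=
    summable_mul_of_summable_norm hb.norm hv.norm
  obtain ⟨C, hC⟩ := bdd_aux ha
  have h2 : Summable (Function.uncurry fun k m : L => b k * a (m - k) * v m) := by
    refine Summable.of_norm_bounded (h1.abs.mul_left C) fun p => ?_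
    have : Function.uncurry (fun k m : L => b k * a (m - k) * v m) p
        = a (p.2 - p.1) * (b p.1 * v p.2) := by
      simp only [Function.uncurry]; ring
    rw [this, Real.norm_eq_abs, abs_mul]
    exact mul_le_mul_of_nonneg_right (hC _) (abs_nonneg _)
  calc ∑' k, b k * ampConv a v k = ∑' k, ∑' m, b k * a (m - k) * v m := by
        refine tsum_congr fun k => ?_
        unfold ampConv
        rw [← tsum_mul_left, ← (Equiv.subLeft k).tsum_eq]
        refine tsum_congr fun m => ?_
        rw [Equiv.subLeft_apply, sub_sub_cancel, ← haeven, neg_sub, mul_assoc]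
    _ = ∑' m, ∑' k, b k * a (m - k) * v m := h2.tsum_comm.symm
    _ = ∑' k, ampConv b a k * v k := by
        refine tsum_congr fun m => ?_
        unfold ampConv
        rw [tsum_mul_right]

/-- The identity `(dP_λ)_u v = −⟨F(u,λ), v⟩` from the proof of Proposition 3.5:
`∑ₖ (1−|k|²)² aₖ vₖ − λ ∑ₖ aₖ vₖ + ∑ₖ (a*a)ₖ (a*v)ₖ = −∑ₖ Fₖ vₖ`, where
`Fₖ = −(1−|k|²)² aₖ + λ aₖ − (a*a*a)ₖ`. -/
theorem statement_11 {d : ℕ} (L : AddSubgroup (EuclideanSpace ℝ (Fin d)))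
    (a v : L → ℝ)
    (ha : Summable fun k => |a k|)
    (hv : Summable fun k => |v k|)
    (haeven : ∀ k, a (-k) = a k)
    (hveven : ∀ k, v (-k) = v k)
    (hsum : Summable fun k : L =>
      (1 - ‖(k : EuclideanSpace ℝ (Fin d))‖ ^ 2) ^ 2 * |a k| * |v k|)
    (lam : ℝ)
    (F : L → ℝ)
    (hF : ∀ k : L, F k = -(1 - ‖(k : EuclideanSpace ℝ (Fin d))‖ ^ 2) ^ 2 * a k
        + lam * a k - ampConv (ampConv a a) a k) :
    (∑' k : L, (1 - ‖(k : EuclideanSpace ℝ (Fin d))‖ ^ 2) ^ 2 * (a k * v k))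
      - lam * (∑' k : L, a k * v k)
      + (∑' k : L, ampConv a a k * ampConv a v k)
      = -∑' k : L, F k * v k := by
  have ha' : Summable a := ha.of_abs
  have hv' : Summable v := hv.of_abs
  have haa := conv_summable_aux ha' ha'
  have s1 : Summable fun k : L =>
      (1 - ‖(k : EuclideanSpace ℝ (Fin d))‖ ^ 2) ^ 2 * (a k * v k) := by
    refine Summable.of_norm_bounded hsum fun k => le_of_eq ?_
    rw [Real.norm_eq_abs, abs_mul, abs_mul, abs_of_nonneg (sq_nonneg _), mul_assoc]
  have s2 := mul_summable_aux ha' hv'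
  have s3 := mul_summable_aux (conv_summable_aux haa ha') hv'
  rw [pairing_aux ha' haa hv' haeven, ← tsum_mul_left,
    ← s1.tsum_sub (s2.mul_left lam), ← (s1.sub (s2.mul_left lam)).tsum_add s3, ← tsum_neg]
  refine tsum_congr fun k => ?_
  rw [hF]
  ring
end

section
/- Let S be a finite nonempty set of unit vectors in ℝ² satisfying S = −S, with n = |S| elements, and for k ∈ ℝ² let m(k) = #{(u,v) ∈ S × S : u + v = k}. Then Σ_{k∈ℝ²} m(k)² = 3n² − 3n. (The computation ‖u_λ(0)²‖₂² = (3|H|² − 3|H|) a⁴λ² for planar holohedries H = D_q, which yields g_H = (3|H|−3)/|H| and the constant C_H = 1 − √((4q−3)/(6q−3)) in Theorem 3.1(c) when d = 2) -/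
open scoped Classical

theorem aux_alg (a b u v x y : ℝ) (hA : a ^ 2 + b ^ 2 = 1) (hU : u ^ 2 + v ^ 2 = 1)
    (hV : x ^ 2 + y ^ 2 = 1) (hB : (u + x - a) ^ 2 + (v + y - b) ^ 2 = 1)
    (hpos : (u + x) ^ 2 + (v + y) ^ 2 ≠ 0) : (a = u ∧ b = v) ∨ (a = x ∧ b = y) := by
  have e1 : (a - u) * (u + x) + (b - v) * (v + y) = 0 := by linear_combination (hA - hB + hV - hU) / 2
  have e2 : (a - x) * (u + x) + (b - y) * (v + y) = 0 := by linear_combination (hA - hB + hU - hV) / 2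
  have e3 : (a - u) * (a - x) + (b - v) * (b - y) = 0 := by
    linear_combination (hA + hB - hU - hV) / 2
  have e4 : ((a - u) * (v + y) - (b - v) * (u + x)) * ((a - x) * (v + y) - (b - y) * (u + x)) = 0 := by
    linear_combination ((u + x) ^ 2 + (v + y) ^ 2) * e3 - ((a - x) * (u + x) + (b - y) * (v + y)) * e1
  rcases mul_eq_zero.1 e4 with e | e
  · left
    constructor
    · have : (a - u) * ((u + x) ^ 2 + (v + y) ^ 2) = 0 := by
        linear_combination (u + x) * e1 + (v + y) * e
      linarith [(mul_eq_zero.1 this).resolve_right hpos]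
    · have : (b - v) * ((u + x) ^ 2 + (v + y) ^ 2) = 0 := by
        linear_combination (v + y) * e1 - (u + x) * e
      linarith [(mul_eq_zero.1 this).resolve_right hpos]
  · right
    constructor
    · have : (a - x) * ((u + x) ^ 2 + (v + y) ^ 2) = 0 := by
        linear_combination (u + x) * e2 + (v + y) * e
      linarith [(mul_eq_zero.1 this).resolve_right hpos]
    · have : (b - y) * ((u + x) ^ 2 + (v + y) ^ 2) = 0 := by
        linear_combination (v + y) * e2 - (u + x) * e
      linarith [(mul_eq_zero.1 this).resolve_right hpos]

theorem aux_geom (a u v : EuclideanSpace ℝ (Fin 2)) (ha : ‖a‖ = 1) (hu : ‖u‖ = 1) (hv : ‖v‖ = 1)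
    (b : EuclideanSpace ℝ (Fin 2)) (hb : ‖b‖ = 1)
    (h : a + b = u + v) (hs : u + v ≠ 0) : a = u ∨ a = v := by
  have key : ∀ x : EuclideanSpace ℝ (Fin 2), ‖x‖ = 1 → x 0 ^ 2 + x 1 ^ 2 = 1 := by
    intro x hx
    have := EuclideanSpace.real_norm_sq_eq x
    rw [hx, Fin.sum_univ_two] at this
    linarith
  have hA := key a ha
  have hB := key b hb
  have hU := key u hu
  have hV := key v hv
  have h0 : a 0 + b 0 = u 0 + v 0 := congrArg (fun x : EuclideanSpace ℝ (Fin 2) => x 0) h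
  have h1 : a 1 + b 1 = u 1 + v 1 := congrArg (fun x : EuclideanSpace ℝ (Fin 2) => x 1) h
  have eb0 : b 0 = u 0 + v 0 - a 0 := by linarith
  have eb1 : b 1 = u 1 + v 1 - a 1 := by linarith
  rw [eb0, eb1] at hB
  have hext : ∀ x y : EuclideanSpace ℝ (Fin 2), x 0 = y 0 → x 1 = y 1 → x = y := by
    intro x y e0 e1
    ext i
    fin_cases i
    · exact e0
    · exact e1
  have hpos : (u 0 + v 0) ^ 2 + (u 1 + v 1) ^ 2 ≠ 0 := by
    intro hz
    apply hs
    apply hext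
    · change u 0 + v 0 = 0
      nlinarith [sq_nonneg (u 0 + v 0), sq_nonneg (u 1 + v 1)]
    · change u 1 + v 1 = 0
      nlinarith [sq_nonneg (u 0 + v 0), sq_nonneg (u 1 + v 1)]
  rcases aux_alg _ _ _ _ _ _ hA hU hV hB hpos with ⟨e0, e1⟩ | ⟨e0, e1⟩
  · exact Or.inl (hext _ _ e0 e1)
  · exact Or.inr (hext _ _ e0 e1)

/-- The computation `∑ₖ m(k)² = 3n² − 3n` for a finite nonempty symmetric set `S`
of `n` unit vectors in the plane, where `m(k)` is the multiplicity of `k` as a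
pairwise sum of elements of `S` (used to compute `g_H` and the constant `C_H` in
Theorem 3.1(c) when `d = 2`). -/
theorem statement_13 (S : Finset (EuclideanSpace ℝ (Fin 2)))
    (hS : S.Nonempty)
    (hunit : ∀ x ∈ S, ‖x‖ = 1)
    (hsymm : ∀ x ∈ S, -x ∈ S)
    (n : ℕ) (hn : n = S.card)
    (m : EuclideanSpace ℝ (Fin 2) → ℕ)
    (hm : ∀ k, m k = ((S ×ˢ S).filter fun p => p.1 + p.2 = k).card) :
    (∑' k : EuclideanSpace ℝ (Fin 2), ((m k : ℝ)) ^ 2) = 3 * (n : ℝ) ^ 2 - 3 * n := by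
  have hfib : ∀ u ∈ S, ∀ v ∈ S, (m (u + v) : ℝ) =
      2 + (if v = u then (-1 : ℝ) else 0) + (if v = -u then (n : ℝ) - 2 else 0) := by
    intro u hu v hv
    have hu0 : u ≠ 0 := by
      intro h
      have := hunit u hu
      simp [h] at this
    have hne : u ≠ -u := by
      intro h
      apply hu0
      have h2 : (2 : ℝ) • u = 0 := by
        rw [two_smul]
        exact add_eq_zero_iff_eq_neg.2 h
      exact (smul_eq_zero.1 h2).resolve_left two_ne_zero
    by_cases h1 : v = -u
    · subst h1
      rw [if_neg hne.symm, if_pos rfl, hm]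
      have : ((S ×ˢ S).filter fun p => p.1 + p.2 = u + -u) = S.image (fun x => (x, -x)) := by
        ext ⟨a, b⟩
        simp only [Finset.mem_filter, Finset.mem_product, Finset.mem_image, Prod.mk.injEq,
          add_neg_cancel]
        constructor
        · rintro ⟨⟨ha, hb⟩, h⟩
          exact ⟨a, ha, rfl, (eq_neg_of_add_eq_zero_right h).symm⟩
        · rintro ⟨x, hx, rfl, rfl⟩
          exact ⟨⟨hx, hsymm x hx⟩, add_neg_cancel x⟩
      rw [this, Finset.card_image_of_injective _ (fun x y h => (Prod.mk.inj h).1), ← hn]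
      ring
    · have hs : u + v ≠ 0 := fun h => h1 (eq_neg_of_add_eq_zero_right h)
      have : ((S ×ˢ S).filter fun p => p.1 + p.2 = u + v) = {(u, v), (v, u)} := by
        ext ⟨a, b⟩
        simp only [Finset.mem_filter, Finset.mem_product, Finset.mem_insert,
          Finset.mem_singleton, Prod.mk.injEq]
        constructor
        · rintro ⟨⟨ha, hb⟩, h⟩
          rcases aux_geom a u v (hunit a ha) (hunit u hu) (hunit v hv) b (hunit b hb) h hs
            with rfl | rfl
          · exact Or.inl ⟨rfl, add_left_cancel h⟩
          · exact Or.inr ⟨rfl, add_left_cancel (h.trans (add_comm _ _))⟩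
        · rintro (⟨rfl, rfl⟩ | ⟨rfl, rfl⟩)
          · exact ⟨⟨hu, hv⟩, rfl⟩
          · exact ⟨⟨hv, hu⟩, add_comm _ _⟩
      rw [hm, this, if_neg h1]
      by_cases h2 : v = u
      · subst h2
        norm_num
      · rw [if_neg h2, Finset.card_pair (by
          intro h
          exact h2 (Prod.mk.inj h).2)]
        norm_num
  have hsum : (∑' k : EuclideanSpace ℝ (Fin 2), ((m k : ℝ)) ^ 2)
      = ∑ p ∈ S ×ˢ S, (m (p.1 + p.2) : ℝ) := by
    rw [Finset.sum_comp (fun k => (m k : ℝ)) (fun p : _ × _ => p.1 + p.2),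
      tsum_eq_sum (s := (S ×ˢ S).image fun p => p.1 + p.2)]
    · apply Finset.sum_congr rfl
      intro k _
      rw [nsmul_eq_mul, ← hm, sq]
    · intro k hk
      have : m k = 0 := by
        rw [hm, Finset.card_eq_zero, Finset.filter_eq_empty_iff]
        intro p hp h
        exact hk (Finset.mem_image.2 ⟨p, hp, h⟩)
      simp [this]
  rw [hsum, Finset.sum_product]
  have : ∀ u ∈ S, ∑ v ∈ S, (m (u + v) : ℝ) = 3 * n - 3 := by
    intro u hu
    rw [Finset.sum_congr rfl (hfib u hu), Finset.sum_add_distrib, Finset.sum_add_distrib,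
      Finset.sum_ite_eq', Finset.sum_ite_eq', if_pos hu, if_pos (hsymm u hu), Finset.sum_const,
      ← hn, nsmul_eq_mul]
    ring
  rw [Finset.sum_congr rfl this, Finset.sum_const, ← hn, nsmul_eq_mul]
  ring
end

section
/- Let a : L → ℝ be absolutely summable and even with Σ_{k∈L} (1−|k|²)² a_k² < ∞. Let 0 < ε < 1, λ ≥ 0 and r > 0 with λ ≤ ε r². If Σ_{k∈L, ||k|²−1| < r} a_k² ≤ (1−ε) Σ_{k∈L} a_k², then P_λ(a) ≥ 0. (Proposition 3.9: if the energy of u is not (1−ε)-concentrated on the Fourier modes with ||k|²−1| < r, then P_λ(u) ≥ 0) -/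
/-- The Swift–Hohenberg potential `P_λ(u) = ½‖(Δ+1)u‖₂² − ½λ‖u‖₂² + ¼‖u²‖₂²`
expressed in Fourier amplitudes. -/
noncomputable def pot {d : ℕ} {L : AddSubgroup (EuclideanSpace ℝ (Fin d))}
    (lam : ℝ) (a : L → ℝ) : ℝ :=
  (1 / 2) * (∑' k : L, (1 - ‖(k : EuclideanSpace ℝ (Fin d))‖ ^ 2) ^ 2 * (a k) ^ 2)
    - (lam / 2) * (∑' k : L, (a k) ^ 2)
    + (1 / 4) * (∑' k : L, (ampConv a a k) ^ 2)

/-- Proposition 3.9: if `0 < ε < 1`, `λ ≥ 0`, `r > 0` with `λ ≤ εr²`, and the energy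
of `u` is not `(1−ε)`-concentrated on the Fourier modes with `||k|²−1| < r`, then
`P_λ(u) ≥ 0`. -/
theorem statement_16 {d : ℕ} (L : AddSubgroup (EuclideanSpace ℝ (Fin d)))
    (a : L → ℝ)
    (ha : Summable fun k => |a k|)
    (haeven : ∀ k, a (-k) = a k)
    (ha2 : Summable fun k : L => (1 - ‖(k : EuclideanSpace ℝ (Fin d))‖ ^ 2) ^ 2 * (a k) ^ 2)
    (eps lam r : ℝ)
    (heps0 : 0 < eps) (heps1 : eps < 1) (hlam : 0 ≤ lam) (hr : 0 < r)
    (hlamr : lam ≤ eps * r ^ 2)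
    (hconc : (∑' k : {k : L // |‖(k : EuclideanSpace ℝ (Fin d))‖ ^ 2 - 1| < r}, (a k.1) ^ 2)
      ≤ (1 - eps) * ∑' k : L, (a k) ^ 2) :
    0 ≤ pot lam a := by
  have hsq : Summable fun k : L => (a k) ^ 2 := by
    have h := ha.tendsto_cofinite_zero
    refine Summable.of_norm_bounded_eventually (g := fun k => |a k|) ha ?_
    filter_upwards [h.eventually (gt_mem_nhds (zero_lt_one))] with k hk
    rw [Real.norm_eq_abs, abs_of_nonneg (sq_nonneg _), ← sq_abs]
    nlinarith [abs_nonneg (a k)]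
  let s : Set L := {k : L | |‖(k : EuclideanSpace ℝ (Fin d))‖ ^ 2 - 1| < r}
  have hA : (∑' k : {k : L // |‖(k : EuclideanSpace ℝ (Fin d))‖ ^ 2 - 1| < r}, (a k.1) ^ 2)
      = ∑' k : L, s.indicator (fun k => (a k) ^ 2) k :=
    tsum_subtype s (fun k => (a k) ^ 2)
  have hsA : Summable (s.indicator (fun k : L => (a k) ^ 2)) := hsq.indicator s
  have key : r ^ 2 * (∑' k : L, (a k) ^ 2 - ∑' k : L, s.indicator (fun k => (a k) ^ 2) k)
      ≤ ∑' k : L, (1 - ‖(k : EuclideanSpace ℝ (Fin d))‖ ^ 2) ^ 2 * (a k) ^ 2 := by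
    rw [← hsq.tsum_sub hsA, ← tsum_mul_left]
    refine Summable.tsum_le_tsum ?_ ((hsq.sub hsA).mul_left _) ha2
    intro k
    by_cases hk : k ∈ s
    · rw [Set.indicator_of_mem hk, sub_self, mul_zero]
      positivity
    · rw [Set.indicator_of_notMem hk, sub_zero]
      have hk' : r ≤ |‖(k : EuclideanSpace ℝ (Fin d))‖ ^ 2 - 1| := not_lt.mp hk
      refine mul_le_mul_of_nonneg_right ?_ (sq_nonneg _)
      rw [abs_sub_comm] at hk'
      rw [← sq_abs (1 - ‖(k : EuclideanSpace ℝ (Fin d))‖ ^ 2)]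
      exact pow_le_pow_left₀ hr.le hk' 2
  rw [hA] at hconc
  have hS : 0 ≤ ∑' k : L, (a k) ^ 2 := tsum_nonneg fun k => sq_nonneg _
  have hC : 0 ≤ ∑' k : L, (ampConv a a k) ^ 2 := tsum_nonneg fun k => sq_nonneg _
  have h1 := mul_le_mul_of_nonneg_right hlamr hS
  have h2 := mul_le_mul_of_nonneg_left hconc (sq_nonneg r)
  unfold pot
  nlinarith
end

section
/- Let a : L → ℝ be absolutely summable and even with Σ_{k∈L} (1−|k|²)² a_k² < ∞, and let λ > 0 and g ≥ 1. If P_λ(a) ≤ −λ²/(4g), then Σ_{k∈L} a_k² ≥ (1 − √(1 − 1/g)) λ. (The lower bound mechanism of Theorem 3.1(c): since P_λ is nonincreasing along Swift–Hohenberg trajectories and P_λ(u_λ(0)) = −λ²/(4g_H), every state u_λ(t) on such a trajectory satisfies ‖u_λ(t)‖₂² ≥ C_H λ with C_H = 1 − √(1 − 1/g_H)) -/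
/-- An absolutely summable real family is square summable. -/
theorem summable_sq_aux {ι : Type*} (f : ι → ℝ) (hf : Summable fun k => |f k|) :
    Summable fun k => (f k) ^ 2 := by
  refine Summable.of_nonneg_of_le (fun k => sq_nonneg _) (fun k => ?_)
    (hf.mul_left (∑' k, |f k|))
  have h1 : |f k| ≤ ∑' k, |f k| := hf.le_tsum k (fun j _ => abs_nonneg _)
  rw [← sq_abs, sq]
  exact mul_le_mul_of_nonneg_right h1 (abs_nonneg _)

/-- The self-convolution of an absolutely summable family is absolutely summable. -/
theorem summable_conv_aux {G : Type*} [AddCommGroup G] (a : G → ℝ)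
    (ha : Summable fun k => |a k|) :
    Summable fun k => |∑' m, a m * a (k - m)| := by
  have h1 : Summable fun p : G × G => a p.1 * a p.2 :=
    summable_mul_of_summable_norm (f := a) (g := a) (by simpa using ha) (by simpa using ha)
  have hinj : Function.Injective (fun p : G × G => ((p.2, p.1 - p.2) : G × G)) := by
    rintro ⟨x, y⟩ ⟨z, w⟩ h
    simp only [Prod.mk.injEq] at h
    obtain ⟨rfl, h⟩ := h
    simpa using h
  have h2 := h1.comp_injective hinj
  exact h2.prod.abs

/-- The lower bound mechanism of Theorem 3.1(c): if `λ > 0`, `g ≥ 1` and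
`P_λ(a) ≤ −λ²/(4g)`, then `∑ₖ aₖ² ≥ (1 − √(1 − 1/g))λ`. -/
theorem statement_17 {d : ℕ} (L : AddSubgroup (EuclideanSpace ℝ (Fin d)))
    (a : L → ℝ)
    (ha : Summable fun k => |a k|)
    (haeven : ∀ k, a (-k) = a k)
    (ha2 : Summable fun k : L => (1 - ‖(k : EuclideanSpace ℝ (Fin d))‖ ^ 2) ^ 2 * (a k) ^ 2)
    (lam g : ℝ) (hlam : 0 < lam) (hg : 1 ≤ g)
    (hpot : pot lam a ≤ -lam ^ 2 / (4 * g)) :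
    (∑' k : L, (a k) ^ 2) ≥ (1 - Real.sqrt (1 - 1 / g)) * lam := by
  have hS2 := summable_conv_aux a ha
  have hS3 := summable_sq_aux _ hS2
  have h0 : ampConv a a 0 = ∑' k : L, (a k) ^ 2 := by
    unfold ampConv
    refine tsum_congr fun m => ?_
    rw [zero_sub, haeven, sq]
  have h1 : (∑' k : L, (a k) ^ 2) ^ 2 ≤ ∑' k : L, (ampConv a a k) ^ 2 := by
    rw [← h0]
    exact Summable.le_tsum (f := fun k : L => (ampConv a a k) ^ 2) hS3 0
      (fun j _ => sq_nonneg _)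
  have h2 : 0 ≤ ∑' k : L, (1 - ‖(k : EuclideanSpace ℝ (Fin d))‖ ^ 2) ^ 2 * (a k) ^ 2 :=
    tsum_nonneg fun k => by positivity
  unfold pot at hpot
  set S := ∑' k : L, (a k) ^ 2
  have hgpos : 0 < g := by linarith
  have e : -lam ^ 2 / (4 * g) = -(lam ^ 2 * (1 / g)) / 4 := by field_simp
  rw [e] at hpot
  have hg1 : 0 ≤ 1 - 1 / g := by
    rw [sub_nonneg, div_le_one hgpos]; exact hg
  have h3 : (lam - S) ^ 2 ≤ (Real.sqrt (1 - 1 / g) * lam) ^ 2 := by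
    rw [mul_pow, Real.sq_sqrt hg1]
    nlinarith
  have h4 := abs_le_of_sq_le_sq h3 (by positivity)
  linarith [(abs_le.mp h4).2]
end
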